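/- Let (α, μ) be a measure space and let p, q : α → ℝ be measurable functions with p x > 0 and q x > 0 for all x. Define D*(x) = p x / (p x + q x), and let D : α → ℝ be a measurable function with D x ∈ (0,1) for all x such that both loss integrands are integrable. If ∫ (-(p x) * log (D x) - (q x) * log (1 - D x)) dμ = ∫ (-(p x) * log (D* x) - (q x) * log (1 - D* x)) dμ, then D = D* μ-almost everywhere. -/

import Mathlib

open MeasureTheory

/-- Gibbs' inequality for a two-point distribution with unnormalized weights `a` and `b`,
in strict form. -/
lemma binary_cross_entropy_lt {a b d : ℝ} (ha : 0 < a) (hb : 0 < b)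
    (hd : d ∈ Set.Ioo (0 : ℝ) 1) (hne : d ≠ a / (a + b)) :
    -a * Real.log (a / (a + b)) - b * Real.log (1 - a / (a + b)) <
      -a * Real.log d - b * Real.log (1 - d) := by
  have hs : 0 < a + b := add_pos ha hb
  have hd1 : 0 < 1 - d := sub_pos.2 hd.2
  have hcompl : 1 - a / (a + b) = b / (a + b) := by field_simp; ring
  have hlog_a : Real.log (d / (a / (a + b))) < d / (a / (a + b)) - 1 :=
    Real.log_lt_sub_one_of_pos (div_pos hd.1 (div_pos ha hs))
      fun h => hne ((div_eq_one_iff_eq (div_pos ha hs).ne').1 h)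
  have hlog_b : Real.log ((1 - d) / (b / (a + b))) ≤ (1 - d) / (b / (a + b)) - 1 :=
    Real.log_le_sub_one_of_pos (div_pos hd1 (div_pos hb hs))
  rw [Real.log_div hd.1.ne' (div_pos ha hs).ne'] at hlog_a
  rw [Real.log_div hd1.ne' (div_pos hb hs).ne'] at hlog_b
  have hmul_a := mul_lt_mul_of_pos_left hlog_a ha
  have hmul_b := mul_le_mul_of_nonneg_left hlog_b hb.le
  have hsum : a * (d / (a / (a + b)) - 1) + b * ((1 - d) / (b / (a + b)) - 1) = 0 := by
    field_simp
    ring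
  rw [hcompl]
  linarith

/-- Uniqueness of the optimal discriminator: if a measurable discriminator `D` with
values in `(0,1)` achieves the same binary cross-entropy loss as
`D*(x) = p x / (p x + q x)`, then `D = D*` `μ`-almost everywhere. -/
theorem optimal_discriminator_unique
    {α : Type*} [MeasurableSpace α] (μ : Measure α) (p q D : α → ℝ)
    (hp : Measurable p) (hq : Measurable q)
    (hppos : ∀ x, 0 < p x) (hqpos : ∀ x, 0 < q x)
    (hD : Measurable D) (hD01 : ∀ x, D x ∈ Set.Ioo (0 : ℝ) 1)
    (hintD : Integrable
      (fun x => -(p x) * Real.log (D x) - (q x) * Real.log (1 - D x)) μ)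
    (hintD' : Integrable
      (fun x => -(p x) * Real.log (p x / (p x + q x))
        - (q x) * Real.log (1 - p x / (p x + q x))) μ)
    (heq : ∫ x, (-(p x) * Real.log (D x) - (q x) * Real.log (1 - D x)) ∂μ =
      ∫ x, (-(p x) * Real.log (p x / (p x + q x))
        - (q x) * Real.log (1 - p x / (p x + q x))) ∂μ) :
    D =ᵐ[μ] fun x => p x / (p x + q x) := by
  have hle : ∀ x, -(p x) * Real.log (p x / (p x + q x))
      - (q x) * Real.log (1 - p x / (p x + q x)) ≤
        -(p x) * Real.log (D x) - (q x) * Real.log (1 - D x) := by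
    intro x
    by_cases h : D x = p x / (p x + q x)
    · rw [h]
    · exact (binary_cross_entropy_lt (hppos x) (hqpos x) (hD01 x) h).le
  have hae := (integral_eq_iff_of_ae_le hintD' hintD (Filter.Eventually.of_forall hle)).1 heq.symm
  filter_upwards [hae] with x hx
  by_contra h
  exact (binary_cross_entropy_lt (hppos x) (hqpos x) (hD01 x) h).ne hx
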